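/- Let H be a bivariate max-stable df with unit Fréchet marginals and let Z = (Z₁,Z₂) be a random vector whose df Q has unit Fréchet marginals. Then μ(H,Q) = −E[ln H(Z₁,Z₂)] = 2 if and only if H(x₁,x₂) = Φ(x₁)Φ(x₂) for all (x₁,x₂) ∈ ℝ². -/

import Mathlib

open MeasureTheory Filter Topology ProbabilityTheory
open scoped ENNReal

/-- The unit Fréchet distribution function `Φ(x) = exp(-1/x)` for `x > 0`, `0` otherwise. -/
noncomputable def frechet (x : ℝ) : ℝ := if 0 < x then Real.exp (-(1/x)) else 0

/-- The distribution function of a Borel measure on `ℝ^d`. -/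
noncomputable def df {d : ℕ} (ρ : Measure (Fin d → ℝ)) (x : Fin d → ℝ) : ℝ :=
  (ρ {y | ∀ i, y i ≤ x i}).toReal

/-- The `i`-th marginal distribution function of a Borel measure on `ℝ^d`. -/
noncomputable def marg {d : ℕ} (ρ : Measure (Fin d → ℝ)) (i : Fin d) (t : ℝ) : ℝ :=
  (ρ {y | y i ≤ t}).toReal

/-- All one-dimensional marginal dfs equal the unit Fréchet df. -/
def HasFrechetMarginals {d : ℕ} (ρ : Measure (Fin d → ℝ)) : Prop :=
  ∀ (i : Fin d) (t : ℝ), marg ρ i t = frechet t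

/-- The measure is concentrated on `[0,∞)^d`. -/
def SupportedOnNonneg {d : ℕ} (ρ : Measure (Fin d → ℝ)) : Prop :=
  ρ {y | ∃ i, y i < 0} = 0

/-- Max-infinite divisibility: for every `t > 0`, `H^t` is again a df of a Borel
probability measure. -/
def MaxID {d : ℕ} (ρ : Measure (Fin d → ℝ)) : Prop :=
  ∀ t : ℝ, 0 < t → ∃ ν : Measure (Fin d → ℝ), IsProbabilityMeasure ν ∧
    ∀ x, df ν x = (df ρ x) ^ t

/-- Max-stability (for a df with unit Fréchet marginals):
`H(t x₁, …, t x_d) = H(x₁, …, x_d)^(1/t)` for all `t > 0` and `x ∈ (0,∞)^d`. -/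
def MaxStable {d : ℕ} (ρ : Measure (Fin d → ℝ)) : Prop :=
  ∀ t : ℝ, 0 < t → ∀ x : Fin d → ℝ, (∀ i, 0 < x i) →
    df ρ (fun i => t * x i) = (df ρ x) ^ (1/t)

/-- `υ` is an exponent measure of the max-id df of `ρ`:
`υ{y : y_i > x_i for some i} = -ln H(x)` for all `x ∈ (0,∞)^d`. -/
def IsExponentMeasure {d : ℕ} (ρ υ : Measure (Fin d → ℝ)) : Prop :=
  ∀ x : Fin d → ℝ, (∀ i, 0 < x i) →
    (υ {y | ∃ i, x i < y i}).toReal = - Real.log (df ρ x)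

/-- The positive orthant `(0,∞)^d`. -/
def posOrthant (d : ℕ) : Set (Fin d → ℝ) := {x | ∀ i, 0 < x i}

/-- `F` is in the max-domain of attraction of `H` with norming constants `a_n = n`:
`F(n x)^n → H(x)` for every `x ∈ (0,∞)^d`. -/
def MDA {d : ℕ} (ρ ρH : Measure (Fin d → ℝ)) : Prop :=
  ∀ x : Fin d → ℝ, (∀ i, 0 < x i) →
    Tendsto (fun n : ℕ => (df ρ (fun i => (n : ℝ) * x i)) ^ n) atTop (𝓝 (df ρH x))

theorem frechet_of_pos {x : ℝ} (hx : 0 < x) : frechet x = Real.exp (-(1 / x)) := if_pos hx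

theorem frechet_of_nonpos {x : ℝ} (hx : x ≤ 0) : frechet x = 0 := if_neg hx.not_gt

theorem df_nonneg {d : ℕ} (ρ : Measure (Fin d → ℝ)) (x : Fin d → ℝ) : 0 ≤ df ρ x :=
  ENNReal.toReal_nonneg

theorem df_le_marg {d : ℕ} (ρ : Measure (Fin d → ℝ)) [IsFiniteMeasure ρ] (x : Fin d → ℝ)
    (i : Fin d) : df ρ x ≤ marg ρ i (x i) :=
  measureReal_mono (μ := ρ) (fun _ hy => hy i)

/-- The joint survival probability of a bivariate law, by inclusion-exclusion. -/
theorem measureReal_survival (ρ : Measure (Fin 2 → ℝ)) [IsProbabilityMeasure ρ]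
    (x : Fin 2 → ℝ) :
    ρ.real {y | ∀ i, x i < y i} = 1 - marg ρ 0 (x 0) - marg ρ 1 (x 1) + df ρ x := by
  have hA : MeasurableSet {y : Fin 2 → ℝ | y 0 ≤ x 0} :=
    measurableSet_le (measurable_pi_apply 0) measurable_const
  have hB : MeasurableSet {y : Fin 2 → ℝ | y 1 ≤ x 1} :=
    measurableSet_le (measurable_pi_apply 1) measurable_const
  have hinter : {y : Fin 2 → ℝ | y 0 ≤ x 0} ∩ {y | y 1 ≤ x 1} = {y | ∀ i, y i ≤ x i} := by
    ext y
    simp [Fin.forall_fin_two]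
  have hcompl : ({y : Fin 2 → ℝ | y 0 ≤ x 0} ∪ {y | y 1 ≤ x 1})ᶜ = {y | ∀ i, x i < y i} := by
    ext y
    simp [Fin.forall_fin_two]
  have h1 := measureReal_union_add_inter (μ := ρ) (s := {y : Fin 2 → ℝ | y 0 ≤ x 0}) hB
  have h2 := probReal_compl_eq_one_sub (μ := ρ) (hA.union hB)
  rw [hcompl] at h2
  rw [hinter] at h1
  change _ = 1 - ρ.real _ - ρ.real _ + ρ.real _
  linarith

/-- A max-stable df with unit Fréchet marginals is positive on the positive orthant. -/
theorem MaxStable.df_pos {ρ : Measure (Fin 2 → ℝ)} [IsProbabilityMeasure ρ]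
    (hm : HasFrechetMarginals ρ) (hs : MaxStable ρ) {x : Fin 2 → ℝ} (hx : ∀ i, 0 < x i) :
    0 < df ρ x := by
  refine (df_nonneg ρ x).lt_of_ne' fun h0 => ?_
  have hx0 := hx 0
  have hx1 := hx 1
  set t : ℝ := 4 * (1 / x 0 + 1 / x 1) with ht
  have ht0 : 0 < t := by positivity
  have hst := hs t ht0 x hx
  rw [h0, Real.zero_rpow (by positivity)] at hst
  have h := measureReal_survival ρ (fun i => t * x i)
  have hle : ρ.real {y : Fin 2 → ℝ | ∀ i, t * x i < y i} ≥ 0 := measureReal_nonneg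
  rw [hst, hm, hm, frechet_of_pos (mul_pos ht0 hx0), frechet_of_pos (mul_pos ht0 hx1)] at h
  have e0 := Real.add_one_le_exp (-(1 / (t * x 0)))
  have e1 := Real.add_one_le_exp (-(1 / (t * x 1)))
  have hsum : 1 / (t * x 0) + 1 / (t * x 1) = 1 / 4 := by
    have : 1 / (t * x 0) + 1 / (t * x 1) = (1 / x 0 + 1 / x 1) / t := by field_simp
    rw [this, ht]
    field_simp
  linarith

theorem tendsto_mul_one_sub_exp_neg_div (c : ℝ) :
    Tendsto (fun n : ℕ => (n : ℝ) * (1 - Real.exp (-(c / n)))) atTop (𝓝 c) := by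
  have hd : HasDerivAt (fun s : ℝ => 1 - Real.exp (-(c * s))) c 0 := by
    have h := (((hasDerivAt_id (0 : ℝ)).const_mul c).neg.exp).const_sub 1
    simpa using h
  have h := hd.tendsto_slope_zero_right
  have hn : Tendsto (fun n : ℕ => ((n : ℝ))⁻¹) atTop (𝓝[>] 0) :=
    tendsto_inv_atTop_nhdsGT_zero.comp tendsto_natCast_atTop_atTop
  refine (h.comp hn).congr fun n => ?_
  simp [div_eq_mul_inv]

/-- The defect `1/x₀ + 1/x₁ + ln H(x)` of a bivariate df from independence. -/
noncomputable def independenceDefect (ρ : Measure (Fin 2 → ℝ)) (x : Fin 2 → ℝ) : ℝ :=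
  1 / x 0 + 1 / x 1 + Real.log (df ρ x)

theorem tendsto_mul_survival {ρ : Measure (Fin 2 → ℝ)} [IsProbabilityMeasure ρ]
    (hm : HasFrechetMarginals ρ) (hs : MaxStable ρ) {x : Fin 2 → ℝ} (hx : ∀ i, 0 < x i) :
    Tendsto (fun n : ℕ => (n : ℝ) * ρ.real {y | ∀ i, n * x i < y i}) atTop
      (𝓝 (independenceDefect ρ x)) := by
  have hpos := MaxStable.df_pos hm hs hx
  have h := ((tendsto_mul_one_sub_exp_neg_div (1 / x 0)).add
    (tendsto_mul_one_sub_exp_neg_div (1 / x 1))).sub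
    (tendsto_mul_one_sub_exp_neg_div (-Real.log (df ρ x)))
  rw [sub_neg_eq_add] at h
  refine h.congr' ?_
  filter_upwards [eventually_gt_atTop 0] with n hn
  have hn' : (0 : ℝ) < n := by exact_mod_cast hn
  rw [measureReal_survival ρ (fun i => n * x i), hm, hm, frechet_of_pos (mul_pos hn' (hx 0)),
    frechet_of_pos (mul_pos hn' (hx 1)), hs n hn' x hx, Real.rpow_def_of_pos hpos]
  have e : ∀ a : ℝ, 1 / (n * a) = 1 / a / n := fun a => by rw [div_div, mul_comm]
  have e2 : -(-Real.log (df ρ x) / n) = Real.log (df ρ x) * (1 / n) := by ring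
  rw [e, e, e2]
  ring

theorem independenceDefect_nonneg {ρ : Measure (Fin 2 → ℝ)} [IsProbabilityMeasure ρ]
    (hm : HasFrechetMarginals ρ) (hs : MaxStable ρ) {x : Fin 2 → ℝ} (hx : ∀ i, 0 < x i) :
    0 ≤ independenceDefect ρ x :=
  ge_of_tendsto' (tendsto_mul_survival hm hs hx) fun _ => by positivity

theorem independenceDefect_anti {ρ : Measure (Fin 2 → ℝ)} [IsProbabilityMeasure ρ]
    (hm : HasFrechetMarginals ρ) (hs : MaxStable ρ) {x y : Fin 2 → ℝ} (hx : ∀ i, 0 < x i)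
    (hxy : ∀ i, x i ≤ y i) : independenceDefect ρ y ≤ independenceDefect ρ x := by
  refine le_of_tendsto_of_tendsto'
    (tendsto_mul_survival hm hs fun i => (hx i).trans_le (hxy i))
    (tendsto_mul_survival hm hs hx) fun n => ?_
  refine mul_le_mul_of_nonneg_left (measureReal_mono fun z hz i => ?_) n.cast_nonneg
  exact (mul_le_mul_of_nonneg_left (hxy i) n.cast_nonneg).trans_lt (hz i)

theorem independenceDefect_smul {ρ : Measure (Fin 2 → ℝ)} [IsProbabilityMeasure ρ]
    (hm : HasFrechetMarginals ρ) (hs : MaxStable ρ) {x : Fin 2 → ℝ} (hx : ∀ i, 0 < x i)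
    {t : ℝ} (ht : 0 < t) :
    independenceDefect ρ (fun i => t * x i) = 1 / t * independenceDefect ρ x := by
  simp only [independenceDefect]
  rw [hs t ht x hx, Real.log_rpow (MaxStable.df_pos hm hs hx), ← one_div_mul_one_div,
    ← one_div_mul_one_div]
  ring

/-- Independence at a single point of the positive orthant propagates to the whole orthant. -/
theorem independenceDefect_eq_zero {ρ : Measure (Fin 2 → ℝ)} [IsProbabilityMeasure ρ]
    (hm : HasFrechetMarginals ρ) (hs : MaxStable ρ) {z : Fin 2 → ℝ} (hz : ∀ i, 0 < z i)
    (hz0 : independenceDefect ρ z = 0) {x : Fin 2 → ℝ} (hx : ∀ i, 0 < x i) :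
    independenceDefect ρ x = 0 := by
  refine le_antisymm ?_ (independenceDefect_nonneg hm hs hx)
  set t : ℝ := min (x 0 / z 0) (x 1 / z 1) with htdef
  have ht : 0 < t := lt_min (div_pos (hx 0) (hz 0)) (div_pos (hx 1) (hz 1))
  have hle : ∀ i, t * z i ≤ x i := by
    rw [Fin.forall_fin_two]
    exact ⟨(le_div_iff₀ (hz 0)).1 (min_le_left _ _), (le_div_iff₀ (hz 1)).1 (min_le_right _ _)⟩
  have h := independenceDefect_anti hm hs (fun i => mul_pos ht (hz i)) hle
  rwa [independenceDefect_smul hm hs hz ht, hz0, mul_zero] at h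

theorem HasFrechetMarginals.ae_pos {d : ℕ} {ρ : Measure (Fin d → ℝ)} [IsFiniteMeasure ρ]
    (hm : HasFrechetMarginals ρ) : ∀ᵐ z ∂ρ, ∀ i, 0 < z i := by
  rw [ae_all_iff]
  intro i
  have h : ρ.real {y | y i ≤ 0} = 0 := (hm i 0).trans (frechet_of_nonpos le_rfl)
  rw [measureReal_eq_zero_iff] at h
  simpa [ae_iff] using h

theorem HasFrechetMarginals.lintegral_one_div {d : ℕ} {ρ : Measure (Fin d → ℝ)}
    [IsFiniteMeasure ρ] (hm : HasFrechetMarginals ρ) (i : Fin d) :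
    ∫⁻ z, ENNReal.ofReal (1 / z i) ∂ρ = 1 := by
  have hnn : 0 ≤ᵐ[ρ] fun z => 1 / z i := by
    filter_upwards [hm.ae_pos] with z hz
    exact one_div_nonneg.2 (hz i).le
  have hmeas : AEMeasurable (fun z : Fin d → ℝ => 1 / z i) ρ :=
    Measurable.aemeasurable (by fun_prop)
  rw [lintegral_eq_lintegral_meas_le ρ hnn hmeas]
  have hset : ∀ t ∈ Set.Ioi (0 : ℝ), ρ {z | t ≤ 1 / z i} = ENNReal.ofReal (Real.exp (-t)) := by
    intro t ht
    have ht' : 0 < t := ht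
    have hae : {z : Fin d → ℝ | t ≤ 1 / z i} =ᵐ[ρ] {z | z i ≤ 1 / t} := by
      filter_upwards [hm.ae_pos] with z hz
      exact propext (le_one_div ht' (hz i))
    have h : ρ.real {y | y i ≤ 1 / t} = frechet (1 / t) := hm i (1 / t)
    rw [frechet_of_pos (one_div_pos.2 ht'), one_div_one_div] at h
    rw [measure_congr hae, ← h, ofReal_measureReal]
  rw [setLIntegral_congr_fun measurableSet_Ioi hset, ← ofReal_integral_eq_lintegral_ofReal
    (integrableOn_exp_neg_Ioi 0) (ae_of_all _ fun _ => (Real.exp_pos _).le),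
    integral_exp_neg_Ioi_zero, ENNReal.ofReal_one]

theorem HasFrechetMarginals.integrable_one_div {d : ℕ} {ρ : Measure (Fin d → ℝ)}
    [IsFiniteMeasure ρ] (hm : HasFrechetMarginals ρ) (i : Fin d) :
    Integrable (fun z => 1 / z i) ρ := by
  have hmeas : AEStronglyMeasurable (fun z : Fin d → ℝ => 1 / z i) ρ :=
    Measurable.aestronglyMeasurable (by fun_prop)
  refine ⟨hmeas, (hasFiniteIntegral_iff_ofReal ?_).2 ?_⟩
  · filter_upwards [hm.ae_pos] with z hz
    exact one_div_nonneg.2 (hz i).le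
  · rw [hm.lintegral_one_div i]
    exact ENNReal.one_lt_top

theorem HasFrechetMarginals.integral_one_div {d : ℕ} {ρ : Measure (Fin d → ℝ)}
    [IsFiniteMeasure ρ] (hm : HasFrechetMarginals ρ) (i : Fin d) :
    ∫ z, 1 / z i ∂ρ = 1 := by
  rw [integral_eq_lintegral_of_nonneg_ae ?_ (hm.integrable_one_div i).1,
    hm.lintegral_one_div i, ENNReal.toReal_one]
  filter_upwards [hm.ae_pos] with z hz
  exact one_div_nonneg.2 (hz i).le

/-- For a bivariate max-stable df `H` with unit Fréchet marginals and `Z`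
with df `Q` having unit Fréchet marginals, `μ(H,Q) = -E[ln H(Z₁,Z₂)] = 2` iff
`H(x₁,x₂) = Φ(x₁)Φ(x₂)` for all `(x₁,x₂) ∈ ℝ²`. -/
theorem stmt13 (ρH ρQ : Measure (Fin 2 → ℝ))
    [IsProbabilityMeasure ρH] [IsProbabilityMeasure ρQ]
    (hHm : HasFrechetMarginals ρH) (hQm : HasFrechetMarginals ρQ)
    (hHms : MaxStable ρH) :
    -(∫ z, Real.log (df ρH z) ∂ρQ) = 2 ↔
      ∀ x : Fin 2 → ℝ, df ρH x = frechet (x 0) * frechet (x 1) := by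
  have hint := (hQm.integrable_one_div 0).add (hQm.integrable_one_div 1)
  have hsum : ∫ z, (1 / z 0 + 1 / z 1) ∂ρQ = 2 := by
    rw [integral_add (hQm.integrable_one_div 0) (hQm.integrable_one_div 1),
      hQm.integral_one_div, hQm.integral_one_div]
    norm_num
  constructor
  · intro h
    have hlog : Integrable (fun z => Real.log (df ρH z)) ρQ := by
      by_contra hni
      rw [integral_undef hni] at h
      norm_num at h
    have hzero : ∫ z, independenceDefect ρH z ∂ρQ = 0 := by
      have := integral_add hint hlog
      simp only [Pi.add_apply] at this
      simp only [independenceDefect]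
      rw [this, hsum]
      linarith
    have hnn : 0 ≤ᵐ[ρQ] independenceDefect ρH := by
      filter_upwards [hQm.ae_pos] with z hz
      exact independenceDefect_nonneg hHm hHms hz
    have hae := (integral_eq_zero_iff_of_nonneg_ae hnn (hint.add hlog)).1 hzero
    obtain ⟨z, hz, hz0⟩ := (hQm.ae_pos.and hae).exists
    intro x
    by_cases hx : ∀ i, 0 < x i
    · have h0 := independenceDefect_eq_zero hHm hHms hz hz0 hx
      rw [frechet_of_pos (hx 0), frechet_of_pos (hx 1), ← Real.exp_add,
        ← Real.exp_log (MaxStable.df_pos hHm hHms hx)]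
      congr 1
      simp only [independenceDefect] at h0
      linarith
    · push Not at hx
      obtain ⟨i, hi⟩ := hx
      have hle := df_le_marg ρH x i
      rw [hHm, frechet_of_nonpos hi] at hle
      rw [le_antisymm hle (df_nonneg ρH x)]
      have h0 : frechet (x i) = 0 := frechet_of_nonpos hi
      match i, h0 with
      | 0, h0 => rw [h0, zero_mul]
      | 1, h0 => rw [h0, mul_zero]
  · intro h
    have hae : (fun z => Real.log (df ρH z)) =ᵐ[ρQ] fun z => -(1 / z 0 + 1 / z 1) := by
      filter_upwards [hQm.ae_pos] with z hz
      rw [h, frechet_of_pos (hz 0), frechet_of_pos (hz 1), ← Real.exp_add, Real.log_exp]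
      ring
    rw [integral_congr_ae hae, integral_neg, neg_neg, hsum]
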